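/- Let G be a gyrogroup. The normal closure ⟨⟨G′⟩⟩ of the commutator subgyrogroup G′ is the unique normal subgyrogroup K of G such that (1) G/K is gyrocommutative, i.e., (a⊕b)⊕K = (gyr[a,b](b⊕a))⊕K for all a,b∈G, and (2) for every gyrogroup homomorphism φ from G into a gyrocommutative gyrogroup A, one has K ⊆ ker φ. -/

import Mathlib

universe u v

/-- A gyrogroup: a groupoid `(G, +)` with a left identity `0`, left inverses `-a`,
gyroautomorphisms `gyr a b` (automorphisms of `(G, +)`) satisfying the left
gyroassociative law, and the left loop property. -/
class Gyrogroup (G : Type u) extends Add G, Zero G, Neg G where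
  /-- (G1) left identity -/
  zero_add' : ∀ a : G, 0 + a = a
  /-- (G2) left inverse -/
  neg_add' : ∀ a : G, -a + a = 0
  /-- (G3) the gyroautomorphisms, as bijections of `G` -/
  gyr : G → G → G ≃ G
  /-- (G3) each `gyr a b` preserves the operation, i.e. is an automorphism -/
  gyr_add' : ∀ a b x y : G, gyr a b (x + y) = gyr a b x + gyr a b y
  /-- (G3) left gyroassociative law -/
  add_gyr_assoc' : ∀ a b c : G, a + (b + c) = (a + b) + gyr a b c
  /-- (G4) left loop property -/
  left_loop' : ∀ a b : G, gyr (a + b) b = gyr a b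

open Gyrogroup

variable {G : Type u}

/-- A subgyrogroup: a nonempty subset closed under the operation and inverses. -/
structure IsSubgyrogroup [Gyrogroup G] (H : Set G) : Prop where
  nonempty : H.Nonempty
  add_mem : ∀ ⦃a : G⦄, a ∈ H → ∀ ⦃b : G⦄, b ∈ H → a + b ∈ H
  neg_mem : ∀ ⦃a : G⦄, a ∈ H → -a ∈ H

/-- A gyrogroup homomorphism: a map preserving the operation. -/
def IsGyroHom [Gyrogroup G] {A : Type v} [Gyrogroup A] (φ : G → A) : Prop :=
  ∀ x y : G, φ (x + y) = φ x + φ y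

/-- The kernel of a map into a gyrogroup. -/
def gyroKer [Gyrogroup G] {A : Type v} [Gyrogroup A] (φ : G → A) : Set G :=
  {x : G | φ x = 0}

/-- A normal subgyrogroup: the kernel of some gyrogroup homomorphism from `G`. -/
def IsNormalSubgyrogroup [Gyrogroup G] (N : Set G) : Prop :=
  IsSubgyrogroup N ∧ ∃ (A : Type u) (instA : Gyrogroup A) (φ : G → A),
    @IsGyroHom G _ A instA φ ∧ N = @gyroKer G _ A instA φ

/-- The gyrocommutator `[a, b] = -(a + b) + gyr a b (b + a)`. -/
def gyroCommutator [Gyrogroup G] (a b : G) : G :=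
  -(a + b) + gyr a b (b + a)

/-- The set of all gyrocommutators of `G`. -/
def gyroCommutatorSet (G : Type u) [Gyrogroup G] : Set G :=
  {x : G | ∃ a b : G, x = gyroCommutator a b}

/-- `K` is the commutator subgyrogroup `G'` of `G`: the smallest subgyrogroup
containing all commutators. -/
def IsCommutatorSubgyrogroup [Gyrogroup G] (K : Set G) : Prop :=
  IsSubgyrogroup K ∧ gyroCommutatorSet G ⊆ K ∧
    ∀ H : Set G, IsSubgyrogroup H → gyroCommutatorSet G ⊆ H → K ⊆ H

/-- `K` is the normal closure `⟨⟨A⟩⟩` of `A`: the smallest normal subgyrogroup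
containing `A`. -/
def IsGyroNormalClosure [Gyrogroup G] (A K : Set G) : Prop :=
  IsNormalSubgyrogroup K ∧ A ⊆ K ∧
    ∀ N : Set G, IsNormalSubgyrogroup N → A ⊆ N → K ⊆ N

/-- The left coset `a ⊕ H`. -/
def lcoset [Gyrogroup G] (a : G) (H : Set G) : Set G := (a + ·) '' H

/-- The right coset `H ⊕ a`. -/
def rcoset [Gyrogroup G] (H : Set G) (a : G) : Set G := (· + a) '' H

/-- A gyrogroup is gyrocommutative if `a + b = gyr a b (b + a)` for all `a, b`. -/
def IsGyrocommutative (G : Type u) [Gyrogroup G] : Prop :=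
  ∀ a b : G, a + b = gyr a b (b + a)

/-- An L-subgyrogroup: a subgyrogroup with `gyr a h (H) = H` for all `a ∈ G`, `h ∈ H`. -/
def IsLSubgyrogroup [Gyrogroup G] (H : Set G) : Prop :=
  IsSubgyrogroup H ∧ ∀ a : G, ∀ h ∈ H, ⇑(gyr a h) '' H = H

/-- A subgroup of a gyrogroup: a subgyrogroup that forms a group under the gyrogroup
operation (equivalently, on which the operation is associative; together with the
closure properties and the identity and inverses inherited from `G`, this makes it
a group). -/
def IsSubgroupOfGyrogroup [Gyrogroup G] (H : Set G) : Prop :=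
  IsSubgyrogroup H ∧ ∀ a ∈ H, ∀ b ∈ H, ∀ c ∈ H, a + (b + c) = (a + b) + c

/-- The left nucleus of `G`. -/
def leftNucleus (G : Type u) [Gyrogroup G] : Set G :=
  {a : G | ∀ b c : G, a + (b + c) = (a + b) + c}

/-- The middle nucleus of `G`. -/
def middleNucleus (G : Type u) [Gyrogroup G] : Set G :=
  {b : G | ∀ a c : G, a + (b + c) = (a + b) + c}

/-- The right nucleus of `G`. -/
def rightNucleus (G : Type u) [Gyrogroup G] : Set G :=
  {c : G | ∀ a b : G, a + (b + c) = (a + b) + c}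

/-- `L(G)`: the set of left gyrotranslations of `G`, viewed as permutations of `G`.
A permutation `σ` is a left gyrotranslation when `σ x = a + x` for some fixed `a`. -/
def LSet (G : Type u) [Gyrogroup G] : Set (Equiv.Perm G) :=
  {σ : Equiv.Perm G | ∃ a : G, ∀ x : G, σ x = a + x}

/-- `L(H)` for a subset `H ⊆ G`: the left gyrotranslations by elements of `H`. -/
def LSetOf [Gyrogroup G] (H : Set G) : Set (Equiv.Perm G) :=
  {σ : Equiv.Perm G | ∃ a ∈ H, ∀ x : G, σ x = a + x}

/-- The left multiplication group `LMlt(G)`: the subgroup of `Sym(G)` generated by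
the left gyrotranslations. -/
def LMlt (G : Type u) [Gyrogroup G] : Subgroup (Equiv.Perm G) :=
  Subgroup.closure (LSet G)

/-- `L(G)'`: the set of products `L_{a₁} ∘ ⋯ ∘ L_{aₙ}` of left gyrotranslations whose
reversed product `L_{aₙ} ∘ ⋯ ∘ L_{a₁}` is the identity. -/
def LPrime (G : Type u) [Gyrogroup G] : Set (Equiv.Perm G) :=
  {σ : Equiv.Perm G | ∃ l : List (Equiv.Perm G),
    (∀ τ ∈ l, τ ∈ LSet G) ∧ σ = l.prod ∧ l.reverse.prod = 1}

/-- `L(G)^# = ⋂_{a ∈ G} L_a ∘ L(G)`. -/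
def LSharp (G : Type u) [Gyrogroup G] : Set (Equiv.Perm G) :=
  {σ : Equiv.Perm G | ∀ ρ ∈ LSet G, ∃ τ ∈ LSet G, σ = ρ * τ}

/-- The radical of `G`: elements whose left gyrotranslation lies in `L(G)'`. -/
def gyroRadical (G : Type u) [Gyrogroup G] : Set G :=
  {a : G | ∃ σ ∈ LPrime G, ∀ x : G, σ x = a + x}

/-- `X` is a normal subgroup of the subgroup `Γ` (as a subset of the ambient group). -/
def IsNormalSubgroupIn {M : Type v} [Group M] (Γ : Subgroup M) (X : Set M) : Prop :=
  X ⊆ (Γ : Set M) ∧ (1 : M) ∈ X ∧ (∀ σ ∈ X, σ⁻¹ ∈ X) ∧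
    (∀ σ ∈ X, ∀ τ ∈ X, σ * τ ∈ X) ∧ ∀ γ ∈ Γ, ∀ σ ∈ X, γ * σ * γ⁻¹ ∈ X

/-- The coaddition `a ⊞ b = a + gyr a (-b) b`. -/
def gyroCoadd [Gyrogroup G] (a b : G) : G := a + gyr a (-b) b

/-- Natural-number multiples: `0 • a = 0`, `(m+1) • a = a + m • a`. -/
def gyroNsmul [Gyrogroup G] : ℕ → G → G
  | 0, _ => 0
  | n + 1, a => a + gyroNsmul n a

/-- The index `[G : H]`: the number of left cosets of `H` in `G`. -/
noncomputable def gyroIndex [Gyrogroup G] (H : Set G) : ℕ :=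
  Set.ncard {S : Set G | ∃ a : G, S = lcoset a H}

namespace Gyrogroup

variable [Gyrogroup G]

theorem neg_add_gyr (a b : G) : -a + (a + b) = gyr (-a) a b := by
  rw [add_gyr_assoc', neg_add', zero_add']

theorem add_left_cancel_gyro {a b c : G} (h : a + b = a + c) : b = c :=
  (gyr (-a) a).injective <| by rw [← neg_add_gyr, ← neg_add_gyr, h]

theorem gyr_zero_left (a b : G) : gyr 0 a b = b := by
  have h := add_gyr_assoc' 0 a b
  rw [zero_add', zero_add'] at h
  exact (add_left_cancel_gyro h).symm

theorem neg_add_add (a b : G) : -a + (a + b) = b := by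
  rw [neg_add_gyr, ← left_loop', neg_add', gyr_zero_left]

theorem add_neg_add (a b : G) : a + (-a + b) = b :=
  add_left_cancel_gyro (neg_add_add a (-a + b))

theorem add_zero_gyro (a : G) : a + 0 = a :=
  add_left_cancel_gyro (a := -a) <| by rw [neg_add_add, neg_add']

theorem add_neg_self (a : G) : a + -a = 0 := by
  rw [← add_zero_gyro (-a), add_neg_add]

theorem neg_add_eq_zero_iff {a b : G} : -a + b = 0 ↔ a = b := by
  refine ⟨fun h => ?_, fun h => by rw [h, neg_add']⟩
  rw [← add_neg_add a b, h, add_zero_gyro]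

end Gyrogroup

namespace IsGyroHom

variable [Gyrogroup G] {A : Type v} [Gyrogroup A] {φ : G → A}

theorem map_zero (h : IsGyroHom φ) : φ 0 = 0 :=
  add_left_cancel_gyro (a := φ 0) <| by rw [← h, zero_add', add_zero_gyro]

theorem map_neg (h : IsGyroHom φ) (a : G) : φ (-a) = -φ a :=
  add_left_cancel_gyro (a := φ a) <| by rw [← h, add_neg_self, add_neg_self, h.map_zero]

theorem map_gyr (h : IsGyroHom φ) (a b c : G) :
    φ (gyr a b c) = gyr (φ a) (φ b) (φ c) :=
  add_left_cancel_gyro (a := φ a + φ b) <| by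
    rw [← add_gyr_assoc', ← h, ← h, ← h, ← h, ← add_gyr_assoc']

theorem isSubgyrogroup_gyroKer (h : IsGyroHom φ) : IsSubgyrogroup (gyroKer φ) where
  nonempty := ⟨0, h.map_zero⟩
  add_mem a ha b hb := by
    change φ a = 0 at ha
    change φ b = 0 at hb
    change φ (a + b) = 0
    rw [h, ha, hb, zero_add']
  neg_mem a ha := by
    change φ a = 0 at ha
    change φ (-a) = 0
    rw [h.map_neg, ha, ← add_zero_gyro (-0 : A), Gyrogroup.neg_add']

theorem neg_add_mem_gyroKer_iff (h : IsGyroHom φ) {a b : G} :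
    -a + b ∈ gyroKer φ ↔ φ a = φ b := by
  change φ (-a + b) = 0 ↔ _
  rw [h, h.map_neg, neg_add_eq_zero_iff]

theorem gyroCommutator_mem_gyroKer_iff (h : IsGyroHom φ) {a b : G} :
    gyroCommutator a b ∈ gyroKer φ ↔
      φ a + φ b = gyr (φ a) (φ b) (φ b + φ a) := by
  rw [gyroCommutator, h.neg_add_mem_gyroKer_iff, h.map_gyr, h, h]

theorem gyroCommutatorSet_subset_gyroKer (h : IsGyroHom φ) (hA : IsGyrocommutative A) :
    gyroCommutatorSet G ⊆ gyroKer φ := by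
  rintro _ ⟨a, b, rfl⟩
  exact h.gyroCommutator_mem_gyroKer_iff.2 (hA _ _)

theorem lcoset_gyroKer (h : IsGyroHom φ) (a : G) :
    lcoset a (gyroKer φ) = {b | φ a = φ b} := by
  ext b
  constructor
  · rintro ⟨k, hk, rfl⟩
    exact h.neg_add_mem_gyroKer_iff.1 ((neg_add_add a k).symm ▸ hk)
  · exact fun hb => ⟨-a + b, h.neg_add_mem_gyroKer_iff.2 hb, add_neg_add a b⟩

theorem gyr_mem_range_iff (h : IsGyroHom φ) {a b : A} (ha : a ∈ Set.range φ)
    (hb : b ∈ Set.range φ) (c : A) : c ∈ Set.range φ ↔ gyr a b c ∈ Set.range φ := by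
  obtain ⟨x, rfl⟩ := ha
  obtain ⟨y, rfl⟩ := hb
  constructor
  · rintro ⟨z, rfl⟩
    exact ⟨gyr x y z, h.map_gyr x y z⟩
  · rintro ⟨w, hw⟩
    refine ⟨(gyr x y).symm w, (gyr (φ x) (φ y)).injective ?_⟩
    rw [← h.map_gyr, Equiv.apply_symm_apply, hw]

/-- The image of a gyrogroup homomorphism, as a gyrogroup. -/
abbrev rangeGyrogroup (h : IsGyroHom φ) : Gyrogroup (Set.range φ) where
  add p q := ⟨p.1 + q.1, by
    obtain ⟨_, x, rfl⟩ := p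
    obtain ⟨_, y, rfl⟩ := q
    exact ⟨x + y, h x y⟩⟩
  zero := ⟨0, 0, h.map_zero⟩
  neg p := ⟨-p.1, by
    obtain ⟨_, x, rfl⟩ := p
    exact ⟨-x, h.map_neg x⟩⟩
  zero_add' p := Subtype.ext (zero_add' p.1)
  neg_add' p := Subtype.ext (neg_add' p.1)
  gyr p q := (gyr p.1 q.1).subtypeEquiv (h.gyr_mem_range_iff p.2 q.2)
  gyr_add' p q x y := Subtype.ext (gyr_add' p.1 q.1 x.1 y.1)
  add_gyr_assoc' p q r := Subtype.ext (add_gyr_assoc' p.1 q.1 r.1)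
  left_loop' p q := Equiv.ext fun r =>
    Subtype.ext (congrArg (fun e : A ≃ A => e r.1) (left_loop' p.1 q.1))

end IsGyroHom

theorem IsNormalSubgyrogroup.lcoset_eq_iff [Gyrogroup G] {N : Set G}
    (hN : IsNormalSubgyrogroup N) {a b : G} : lcoset a N = lcoset b N ↔ -a + b ∈ N := by
  obtain ⟨-, A, instA, φ, hφ, rfl⟩ := hN
  rw [hφ.neg_add_mem_gyroKer_iff, hφ.lcoset_gyroKer, hφ.lcoset_gyroKer]
  refine ⟨fun h => ?_, fun h => by rw [h]⟩
  have hb : b ∈ {c | φ b = φ c} := rfl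
  rwa [← h] at hb

/-- The quotient by a normal subgyrogroup containing all commutators is realised as the
image of a homomorphism, which is then gyrocommutative. -/
theorem IsNormalSubgyrogroup.exists_gyrocommutative [Gyrogroup G] {N : Set G}
    (hN : IsNormalSubgyrogroup N) (hc : gyroCommutatorSet G ⊆ N) :
    ∃ (A : Type u) (_ : Gyrogroup A) (φ : G → A),
      IsGyroHom φ ∧ IsGyrocommutative A ∧ N = gyroKer φ := by
  obtain ⟨-, A, instA, φ, hφ, rfl⟩ := hN
  refine ⟨Set.range φ, hφ.rangeGyrogroup, Set.rangeFactorization φ,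
    fun x y => Subtype.ext (hφ x y), ?_, ?_⟩
  · rintro ⟨_, x, rfl⟩ ⟨_, y, rfl⟩
    exact Subtype.ext (hφ.gyroCommutator_mem_gyroKer_iff.1 (hc ⟨x, y, rfl⟩))
  · ext x
    exact (Subtype.ext_iff (a1 := Set.rangeFactorization φ x)
      (a2 := ⟨0, 0, hφ.map_zero⟩)).symm

/-- the normal closure `⟨⟨G'⟩⟩` of the commutator subgyrogroup is the
unique normal subgyrogroup `K` such that (1) `G/K` is gyrocommutative and
(2) every gyrogroup homomorphism from `G` into a gyrocommutative gyrogroup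
kills `K` (i.e. `K` is contained in its kernel). -/
theorem normal_closure_commutator_unique_property [Gyrogroup G]
    (GP K : Set G) (hGP : IsCommutatorSubgyrogroup GP)
    (hK : IsGyroNormalClosure GP K) :
    ((∀ a b : G, lcoset (a + b) K = lcoset (gyr a b (b + a)) K) ∧
      (∀ (A : Type u) (instA : Gyrogroup A) (φ : G → A),
        @IsGyroHom G _ A instA φ → @IsGyrocommutative A instA →
          K ⊆ @gyroKer G _ A instA φ)) ∧
    ∀ K' : Set G, IsNormalSubgyrogroup K' →
      (∀ a b : G, lcoset (a + b) K' = lcoset (gyr a b (b + a)) K') →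
      (∀ (A : Type u) (instA : Gyrogroup A) (φ : G → A),
        @IsGyroHom G _ A instA φ → @IsGyrocommutative A instA →
          K' ⊆ @gyroKer G _ A instA φ) →
      K' = K := by
  have hc : gyroCommutatorSet G ⊆ K := hGP.2.1.trans hK.2.1
  refine ⟨⟨fun a b => hK.1.lcoset_eq_iff.2 (hc ⟨a, b, rfl⟩), fun A instA φ hφ hA => ?_⟩,
    fun K' hK' hcomm hker => ?_⟩
  · exact hK.2.2 _ ⟨hφ.isSubgyrogroup_gyroKer, A, instA, φ, hφ, rfl⟩
      (hGP.2.2 _ hφ.isSubgyrogroup_gyroKer (hφ.gyroCommutatorSet_subset_gyroKer hA))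
  · refine Set.Subset.antisymm ?_ (hK.2.2 K' hK' (hGP.2.2 K' hK'.1 ?_))
    · obtain ⟨A, instA, φ, hφ, hA, rfl⟩ := hK.1.exists_gyrocommutative hc
      exact hker A instA φ hφ hA
    · rintro _ ⟨a, b, rfl⟩
      exact hK'.lcoset_eq_iff.1 (hcomm a b)
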